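/- arXiv:2005.06690 — 4 statements merged into one kernel-verified Lean document; each statement's English description precedes it below -/
import Mathlib

section
/- Let k be a field and 𝒜 a k-linear Hom-finite, Ext-finite and Krull–Schmidt abelian category. Suppose K = K₁ ⊕ ⋯ ⊕ Kₙ where each Kᵢ is indecomposable and either injective or the first term of an almost split short exact sequence 0 → Kᵢ → Eᵢ → Wᵢ → 0; let W be the direct sum of the Wᵢ over the non-injective Kᵢ. Then for every short exact sequence 0 → K → X → α → Y → 0, the epimorphism α: X → Y is right W-determined. -/
/- Preliminary definitions: the abelian-category instance of the extriangulated
notions of the paper (s-projective/injective morphisms and objects, almost split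
short exact sequences, morphisms determined by objects, etc.). -/

open CategoryTheory CategoryTheory.Limits

attribute [local instance] CategoryTheory.Abelian.hasFiniteBiproducts

universe w v u

variable {𝒜 : Type u} [Category.{v} 𝒜] [Abelian 𝒜]

section ExtDefs

variable [HasExt.{w} 𝒜]

/-- `f : X ⟶ Y` is a projective morphism if `Ext¹(f, A) : Ext¹(Y, A) → Ext¹(X, A)`
is zero for every object `A`. -/
def IsProjMorphism {X Y : 𝒜} (f : X ⟶ Y) : Prop :=
  ∀ (A : 𝒜) (δ : Abelian.Ext Y A 1), (Abelian.Ext.mk₀ f).comp δ (zero_add 1) = 0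

/-- `f : X ⟶ Y` is an injective morphism if `Ext¹(A, f) : Ext¹(A, X) → Ext¹(A, Y)`
is zero for every object `A`. -/
def IsInjMorphism {X Y : 𝒜} (f : X ⟶ Y) : Prop :=
  ∀ (A : 𝒜) (δ : Abelian.Ext A X 1), δ.comp (Abelian.Ext.mk₀ f) (add_zero 1) = 0

/-- An object `P` is (s-)projective when `Ext¹(P, A) = 0` for all `A`. -/
def IsExtProjective (P : 𝒜) : Prop := ∀ (A : 𝒜) (δ : Abelian.Ext P A 1), δ = 0

/-- An object `I` is (s-)injective when `Ext¹(A, I) = 0` for all `A`. -/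
def IsExtInjective (I : 𝒜) : Prop := ∀ (A : 𝒜) (δ : Abelian.Ext A I 1), δ = 0

/-- A short exact sequence `0 → X₁ → X₂ → X₃ → 0` with extension class `η` is
almost split if `η ≠ 0`, the pushout `a_*η` vanishes for every non-section
`a : X₁ ⟶ X'`, and the pullback `c^*η` vanishes for every non-retraction `c : Y' ⟶ X₃`. -/
def IsAlmostSplitSeq {S : ShortComplex 𝒜} (hS : S.ShortExact) : Prop :=
  hS.extClass ≠ 0 ∧
    (∀ (X' : 𝒜) (a : S.X₁ ⟶ X'), ¬ IsSplitMono a →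
      hS.extClass.comp (Abelian.Ext.mk₀ a) (add_zero 1) = 0) ∧
    (∀ (Y' : 𝒜) (c : Y' ⟶ S.X₃), ¬ IsSplitEpi c →
      (Abelian.Ext.mk₀ c).comp hS.extClass (zero_add 1) = 0)

/-- There exists an almost split short exact sequence `0 → A → E → B → 0`. -/
def ExistsAlmostSplitSeq (A B : 𝒜) : Prop :=
  ∃ (E : 𝒜) (i : A ⟶ E) (p : E ⟶ B) (w : i ≫ p = 0)
    (hS : (ShortComplex.mk i p w).ShortExact), IsAlmostSplitSeq hS

/-- There exists an almost split short exact sequence ending at `Y`. -/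
def ExistsAlmostSplitEndingAt (Y : 𝒜) : Prop := ∃ X : 𝒜, ExistsAlmostSplitSeq X Y

/-- There exists an almost split short exact sequence starting at `X`. -/
def ExistsAlmostSplitStartingAt (X : 𝒜) : Prop := ∃ Y : 𝒜, ExistsAlmostSplitSeq X Y

end ExtDefs

/-- `g` factors through `f` (both with target `Y`). -/
def FactorsThru {T X Y : 𝒜} (g : T ⟶ Y) (f : X ⟶ Y) : Prop := ∃ t : T ⟶ X, t ≫ f = g

/-- `f : X ⟶ Y` is right `C`-determined. -/
def RightDetermined (C : 𝒜) {X Y : 𝒜} (f : X ⟶ Y) : Prop :=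
  ∀ (T : 𝒜) (g : T ⟶ Y), (∀ h : C ⟶ T, FactorsThru (h ≫ g) f) → FactorsThru g f

/-- `Y` is a direct summand of `X`. -/
def IsDirectSummand (Y X : 𝒜) : Prop := ∃ (i : Y ⟶ X) (r : X ⟶ Y), i ≫ r = 𝟙 Y

/-- `X` is indecomposable: it is nonzero and in any biproduct decomposition one
of the factors vanishes. -/
def Indec (X : 𝒜) : Prop :=
  ¬ IsZero X ∧ ∀ (A B : 𝒜), Nonempty (X ≅ A ⊞ B) → IsZero A ∨ IsZero B

/-- `h : T ⟶ Z` lies in the radical: for every `u : Z ⟶ T` the composite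
`h ∘ u` lies in the Jacobson radical of `End Z`. -/
def InRadical {T Z : 𝒜} (h : T ⟶ Z) : Prop :=
  ∀ u : Z ⟶ T, (u ≫ h : End Z) ∈ (⊥ : Ideal (End Z)).jacobson

/-- `g : Z ⟶ Y` almost factors through `f : X ⟶ Y`. -/
def AlmostFactorsThru {Z X Y : 𝒜} (g : Z ⟶ Y) (f : X ⟶ Y) : Prop :=
  ¬ FactorsThru g f ∧ ∀ (T : 𝒜) (h : T ⟶ Z), InRadical h → FactorsThru (h ≫ g) f

/-- `y : B ⟶ C` is right almost split. -/
def RightAlmostSplit {B C : 𝒜} (y : B ⟶ C) : Prop :=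
  ¬ IsSplitEpi y ∧ ∀ (B' : 𝒜) (h : B' ⟶ C), ¬ IsSplitEpi h → FactorsThru h y

/-- `f : X ⟶ Y` is right minimal. -/
def RightMinimal {X Y : 𝒜} (f : X ⟶ Y) : Prop := ∀ g : X ⟶ X, g ≫ f = f → IsIso g

/-- A Krull–Schmidt category: every object is a finite biproduct of objects with
local endomorphism rings. -/
def IsKrullSchmidtCat (𝒞 : Type u) [Category.{v} 𝒞] [Abelian 𝒞] : Prop :=
  ∀ X : 𝒞, ∃ (n : ℕ) (Z : Fin n → 𝒞), Nonempty (X ≅ ⨁ Z) ∧ ∀ i, IsLocalRing (End (Z i))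

section LinearStructure

variable {k : Type*} [Field k] [CategoryTheory.Linear k 𝒜] [HasExt.{w} 𝒜]

lemma Ext_mk₀_add {X Y : 𝒜} (f g : X ⟶ Y) :
    Abelian.Ext.mk₀ (f + g) = Abelian.Ext.mk₀ f + Abelian.Ext.mk₀ g := by
  letI := HasDerivedCategory.standard 𝒜
  ext
  simp [ShiftedHom.mk₀, Abelian.Ext.add_hom]

/-- The `k`-module structure on the `Ext`-groups of a `k`-linear abelian category,
given by the composition with `r • 𝟙 X`. -/
noncomputable instance extModule (X Y : 𝒜) (n : ℕ) : Module k (Abelian.Ext X Y n) where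
  smul r e := (Abelian.Ext.mk₀ (r • 𝟙 X)).comp e (zero_add n)
  one_smul e := by
    show (Abelian.Ext.mk₀ ((1 : k) • 𝟙 X)).comp e (zero_add n) = e
    rw [one_smul, Abelian.Ext.mk₀_id_comp]
  mul_smul r s e := by
    show (Abelian.Ext.mk₀ ((r * s) • 𝟙 X)).comp e (zero_add n) =
      (Abelian.Ext.mk₀ (r • 𝟙 X)).comp
        ((Abelian.Ext.mk₀ (s • 𝟙 X)).comp e (zero_add n)) (zero_add n)
    rw [Abelian.Ext.mk₀_comp_mk₀_assoc]
    congr 2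
    rw [Linear.smul_comp, Linear.comp_smul, Category.comp_id, smul_smul]
  smul_zero r := by
    show (Abelian.Ext.mk₀ (r • 𝟙 X)).comp (0 : Abelian.Ext X Y n) (zero_add n) = 0
    exact Abelian.Ext.comp_zero _ Y n n (zero_add n)
  smul_add r e₁ e₂ := by
    show (Abelian.Ext.mk₀ (r • 𝟙 X)).comp (e₁ + e₂) (zero_add n) = _
    rw [Abelian.Ext.comp_add]; rfl
  add_smul r s e := by
    show (Abelian.Ext.mk₀ ((r + s) • 𝟙 X)).comp e (zero_add n) = _
    rw [add_smul, Ext_mk₀_add, Abelian.Ext.add_comp]; rfl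
  zero_smul e := by
    show (Abelian.Ext.mk₀ ((0 : k) • 𝟙 X)).comp e (zero_add n) = 0
    rw [zero_smul, Abelian.Ext.mk₀_zero, Abelian.Ext.zero_comp]

end LinearStructure

section

/-- A short exact sequence can be pushed out along a morphism from its first term. -/
lemma exists_shortExact_pushout {S : ShortComplex 𝒜} (hS : S.ShortExact) {A : 𝒜} (a : S.X₁ ⟶ A) :
    ∃ (Q : 𝒜) (j : A ⟶ Q) (q : Q ⟶ S.X₃) (u : S.X₂ ⟶ Q) (w : j ≫ q = 0),
      (ShortComplex.mk j q w).ShortExact ∧ S.f ≫ u = a ≫ j ∧ u ≫ q = S.g := by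
  have := hS.mono_f
  have := hS.epi_g
  let q : pushout S.f a ⟶ S.X₃ := pushout.desc S.g 0 (by simp)
  have hq : pushout.inl S.f a ≫ q = S.g := pushout.inl_desc _ _ _
  have w : pushout.inr S.f a ≫ q = 0 := pushout.inr_desc _ _ _
  have : Epi (pushout.inl S.f a ≫ q) := by rw [hq]; infer_instance
  have : Epi q := epi_of_epi (pushout.inl S.f a) q
  refine ⟨_, pushout.inr S.f a, q, pushout.inl S.f a, w, ?_, pushout.condition, hq⟩
  refine { exact := ShortComplex.exact_of_g_is_cokernel _ ?_, mono_f := ?_, epi_g := ‹_› }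
  · refine CokernelCofork.IsColimit.ofπ' q w fun {B} b hb => ?_
    have hfb : S.f ≫ pushout.inl S.f a ≫ b = 0 := by
      rw [pushout.condition_assoc, hb, comp_zero]
    refine ⟨hS.exact.desc _ hfb, ?_⟩
    apply pushout.hom_ext
    · rw [reassoc_of% hq, hS.exact.g_desc]
    · rw [reassoc_of% w, zero_comp, hb]
  · dsimp
    infer_instance

/-- A short exact sequence can be pulled back along a morphism to its last term. -/
lemma shortExact_pullback {K X Y T : 𝒜} {ι : K ⟶ X} {α : X ⟶ Y} {w : ι ≫ α = 0}
    (hS : (ShortComplex.mk ι α w).ShortExact) (g : T ⟶ Y) :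
    (ShortComplex.mk (pullback.lift ι 0 (by simp [w])) (pullback.snd α g)
      (pullback.lift_snd _ _ _)).ShortExact := by
  have : Mono ι := hS.mono_f
  have : Epi α := hS.epi_g
  have h0 : ι ≫ α = (0 : K ⟶ T) ≫ g := by simp [w]
  have hl : pullback.lift ι 0 h0 ≫ pullback.fst α g = ι := pullback.lift_fst _ _ _
  have : Mono (pullback.lift ι 0 h0 ≫ pullback.fst α g) := by rw [hl]; infer_instance
  have hm := mono_of_mono (pullback.lift ι 0 h0) (pullback.fst α g)
  refine { exact := ShortComplex.exact_of_f_is_kernel _ ?_, mono_f := hm, epi_g := ?_ }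
  · refine KernelFork.IsLimit.ofι' _ _ fun {B} b hb => ?_
    dsimp at hb
    have hbα : (b ≫ pullback.fst α g) ≫ α = 0 := by
      rw [Category.assoc, pullback.condition, reassoc_of% hb, zero_comp]
    have hlift : hS.exact.lift _ hbα ≫ ι = _ := hS.exact.lift_f _ hbα
    refine ⟨hS.exact.lift _ hbα, ?_⟩
    apply pullback.hom_ext
    · rw [Category.assoc, hl]
      exact hlift
    · rw [Category.assoc, pullback.lift_snd, comp_zero, hb]
  · dsimp
    infer_instance

variable [HasExt.{w} 𝒜]

/-- A morphism from the first term of a short exact sequence extends to the middle term if the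
corresponding pushout of the extension class vanishes. -/
lemma exists_extension_of_extClass_comp_eq_zero {S : ShortComplex 𝒜} (hS : S.ShortExact) {A : 𝒜}
    (a : S.X₁ ⟶ A) (h : hS.extClass.comp (Abelian.Ext.mk₀ a) (add_zero 1) = 0) :
    ∃ u : S.X₂ ⟶ A, S.f ≫ u = a := by
  obtain ⟨x, hx⟩ := Abelian.Ext.contravariant_sequence_exact₁ hS A _ (add_zero 1) h
  obtain ⟨u, rfl⟩ := Abelian.Ext.addEquiv₀.symm.surjective x
  refine ⟨u, Abelian.Ext.addEquiv₀.symm.injective ?_⟩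
  simpa using hx

lemma IsExtInjective.exists_retraction {A Q T : 𝒜} (hA : IsExtInjective A) {j : A ⟶ Q}
    {q : Q ⟶ T} {w : j ≫ q = 0} (hS : (ShortComplex.mk j q w).ShortExact) :
    ∃ r : Q ⟶ A, j ≫ r = 𝟙 A :=
  exists_extension_of_extClass_comp_eq_zero hS (𝟙 A) (hA _ _)

/-- If an almost split sequence starts at `A` and ends at `B`, then a short exact sequence
starting at `A` splits as soon as every morphism from `B` to its last term lifts. -/
lemma ExistsAlmostSplitSeq.exists_retraction {A B Q T : 𝒜} (hAB : ExistsAlmostSplitSeq A B)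
    {j : A ⟶ Q} {q : Q ⟶ T} {w : j ≫ q = 0} (hS : (ShortComplex.mk j q w).ShortExact)
    (hq : ∀ h : B ⟶ T, FactorsThru h q) : ∃ r : Q ⟶ A, j ≫ r = 𝟙 A := by
  obtain ⟨E, i, p, wE, hE, hη, hpush, -⟩ := hAB
  by_contra hr
  have hj : ¬ IsSplitMono j := fun _ => hr ⟨retraction j, IsSplitMono.id j⟩
  have : Mono j := hS.mono_f
  have : Epi p := hE.epi_g
  obtain ⟨u, hu⟩ := exists_extension_of_extClass_comp_eq_zero hE j (hpush Q j hj)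
  dsimp at hu
  have hiuq : i ≫ u ≫ q = 0 := by rw [reassoc_of% hu, w]
  obtain ⟨s, hs⟩ := hq (hE.exact.desc (u ≫ q) hiuq)
  have hps : p ≫ s ≫ q = u ≫ q := by
    rw [hs]
    exact hE.exact.g_desc (u ≫ q) hiuq
  have hv : (u - p ≫ s) ≫ q = 0 := by
    rw [Preadditive.sub_comp, Category.assoc, hps, sub_self]
  have hvj : hS.exact.lift (u - p ≫ s) hv ≫ j = u - p ≫ s := hS.exact.lift_f _ hv
  have hiv : i ≫ hS.exact.lift (u - p ≫ s) hv = 𝟙 A := by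
    rw [← cancel_mono j, Category.assoc, hvj, Preadditive.comp_sub, hu, reassoc_of% wE,
      zero_comp, sub_zero, Category.id_comp]
  apply hη
  have h0 := hE.extClass_comp_assoc
    (Abelian.Ext.mk₀ (hS.exact.lift (u - p ≫ s) hv)) (h := add_zero 1)
  rw [Abelian.Ext.mk₀_comp_mk₀] at h0
  dsimp only at h0
  rwa [hiv, Abelian.Ext.comp_mk₀_id] at h0

end

/-- an epimorphism whose kernel lies in `𝒜_l` is right determined by
the direct sum of the end terms of the corresponding almost split sequences. -/
theorem statement_13 {k : Type*} [Field k] [Linear k 𝒜] [HasExt.{w} 𝒜]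
    (homFin : ∀ A B : 𝒜, FiniteDimensional k (A ⟶ B))
    (extFin : ∀ A B : 𝒜, FiniteDimensional k (Abelian.Ext A B 1))
    (hKS : IsKrullSchmidtCat 𝒜)
    {K : 𝒜} (n : ℕ) (Kf W : Fin n → 𝒜) (eK : K ≅ ⨁ Kf)
    (hind : ∀ i, Indec (Kf i))
    (hW : ∀ i, (IsExtInjective (Kf i) ∧ IsZero (W i)) ∨ ExistsAlmostSplitSeq (Kf i) (W i)) :
    ∀ (X Y : 𝒜) (ι : K ⟶ X) (α : X ⟶ Y) (w : ι ≫ α = 0),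
      (ShortComplex.mk ι α w).ShortExact → RightDetermined (⨁ W) α := by
  intro X Y ι α w hS T g hg
  have hP := shortExact_pullback hS g
  have hret : ∀ i, ∃ r : pullback α g ⟶ Kf i,
      pullback.lift ι 0 (by simp [w]) ≫ r = eK.hom ≫ biproduct.π Kf i := by
    intro i
    obtain ⟨Q, j, q, u, wQ, hQ, hu, huq⟩ :=
      exists_shortExact_pushout hP (eK.hom ≫ biproduct.π Kf i)
    dsimp at hu huq
    obtain ⟨r, hr⟩ : ∃ r : Q ⟶ Kf i, j ≫ r = 𝟙 _ := by
      rcases hW i with ⟨hinj, -⟩ | has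
      · exact hinj.exists_retraction hQ
      · refine has.exists_retraction hQ fun h => ?_
        obtain ⟨t, ht⟩ := hg (biproduct.π W i ≫ h)
        refine ⟨pullback.lift (biproduct.ι W i ≫ t) h (by simp [ht]) ≫ u, ?_⟩
        rw [Category.assoc, huq, pullback.lift_snd]
    refine ⟨u ≫ r, ?_⟩
    rw [reassoc_of% hu, hr, Category.comp_id]
  choose r hr using hret
  have hsplit : pullback.lift ι 0 (by simp [w]) ≫ biproduct.lift r ≫ eK.inv = 𝟙 K := by
    rw [← cancel_mono eK.hom]
    apply biproduct.hom_ext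
    intro i
    simp [hr]
  have : Epi (pullback.snd α g) := hP.epi_g
  let σ := ShortComplex.Splitting.ofExactOfRetraction _ hP.exact _ hsplit this
  have hσ : σ.s ≫ pullback.snd α g = 𝟙 T := σ.s_g
  refine ⟨σ.s ≫ pullback.fst α g, ?_⟩
  rw [Category.assoc, pullback.condition, reassoc_of% hσ]
end

section
/- Let k be a field and 𝒜 a k-linear Hom-finite, Ext-finite and Krull–Schmidt abelian category. Let C be an object such that every indecomposable direct summand of C is either projective or the end term of an almost split short exact sequence; write C ≅ C₁ ⊕ ⋯ ⊕ Cₙ with each Cᵢ indecomposable, for each non-projective Cᵢ fix an almost split short exact sequence 0 → Tᵢ → Eᵢ → Cᵢ → 0, and let T be the direct sum of the Tᵢ over the non-projective Cᵢ. Then for every object Y and every right End(C)-submodule H of Hom(C,Y) containing all projective morphisms C → Y, there exists a short exact sequence 0 → K → X → α → Y → 0 such that α is right C-determined, K is a direct summand of a finite direct sum of copies of T, and H = {h ∈ Hom(C,Y) : h factors through α}. -/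
/- Preliminary definitions: the abelian-category instance of the extriangulated
notions of the paper (s-projective/injective morphisms and objects, almost split
short exact sequences, morphisms determined by objects, etc.). -/

open CategoryTheory CategoryTheory.Limits

attribute [local instance] CategoryTheory.Abelian.hasFiniteBiproducts

universe w v u

variable {𝒜 : Type u} [Category.{v} 𝒜] [Abelian 𝒜]

section ExtRepresentation

open Pretriangulated DerivedCategory

lemma shortExact_of_map_distinguished [HasDerivedCategory.{w} 𝒜] (S : ShortComplex 𝒜)
    (δ : (singleFunctor 𝒜 0).obj S.X₃ ⟶ ((singleFunctor 𝒜 0).obj S.X₁)⟦(1 : ℤ)⟧)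
    (hT : Triangle.mk ((singleFunctor 𝒜 0).map S.f) ((singleFunctor 𝒜 0).map S.g) δ ∈
      distTriang (DerivedCategory 𝒜)) : S.ShortExact := by
  let τ := singleFunctorCompHomologyFunctorIso 𝒜 0
  have hf : Mono ((singleFunctor 𝒜 0 ⋙ homologyFunctor 𝒜 0).map S.f) :=
    (HomologySequence.mono_homologyMap_mor₁_iff _ hT (-1) 0).2
      ((isZero_of_isGE ((singleFunctor 𝒜 0).obj S.X₃) 0 (-1) (by lia)).eq_of_src _ _)
  have hg : Epi ((singleFunctor 𝒜 0 ⋙ homologyFunctor 𝒜 0).map S.g) :=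
    (HomologySequence.epi_homologyMap_mor₂_iff _ hT 0 1).2
      ((isZero_of_isLE ((singleFunctor 𝒜 0).obj S.X₁) 0 1 (by lia)).eq_of_tgt _ _)
  refine ShortComplex.shortExact_of_iso
    (S₁ := S.map (singleFunctor 𝒜 0 ⋙ homologyFunctor 𝒜 0)) (S.mapNatIso τ) ?_
  exact { exact := HomologySequence.exact₂ _ hT 0
          mono_f := hf
          epi_g := hg }

/-- Every class in `Ext¹(Y, K)` is the class of a short exact sequence. -/
lemma exists_shortExact_extClass_eq [HasExt.{w} 𝒜] {Y K : 𝒜} (δ : Abelian.Ext Y K 1) :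
    ∃ (X : 𝒜) (i : K ⟶ X) (p : X ⟶ Y) (w : i ≫ p = 0)
      (hS : (ShortComplex.mk i p w).ShortExact), hS.extClass = δ := by
  let := HasDerivedCategory.standard 𝒜
  let F := singleFunctor 𝒜 0
  obtain ⟨D, a, b, hT⟩ := distinguished_cocone_triangle₂ (X := F.obj K) (Z := F.obj Y) δ.hom
  have : D.IsGE 0 := TStructure.t.isGE₂ _ hT 0
    (inferInstanceAs (((singleFunctor 𝒜 0).obj K).IsGE 0))
    (inferInstanceAs (((singleFunctor 𝒜 0).obj Y).IsGE 0))
  have : D.IsLE 0 := TStructure.t.isLE₂ _ hT 0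
    (inferInstanceAs (((singleFunctor 𝒜 0).obj K).IsLE 0))
    (inferInstanceAs (((singleFunctor 𝒜 0).obj Y).IsLE 0))
  obtain ⟨X, ⟨e⟩⟩ := exists_iso_singleFunctor_obj_of_isGE_of_isLE D 0
  obtain ⟨i, hi⟩ := F.map_surjective (a ≫ e.hom)
  obtain ⟨p, hp⟩ := F.map_surjective (e.inv ≫ b)
  have hT' : Triangle.mk (F.map i) (F.map p) δ.hom ∈ distTriang (DerivedCategory 𝒜) := by
    refine isomorphic_distinguished _ hT _
      (Triangle.isoMk _ _ (Iso.refl _) e.symm (Iso.refl _) ?_ ?_ ?_)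
    · change F.map i ≫ e.inv = 𝟙 (F.obj K) ≫ a
      rw [hi, Category.assoc, e.hom_inv_id, Category.comp_id, Category.id_comp]
    · change F.map p ≫ 𝟙 (F.obj Y) = e.inv ≫ b
      rw [hp, Category.comp_id]
    · change δ.hom ≫ (𝟙 (F.obj K))⟦(1 : ℤ)⟧' = 𝟙 (F.obj Y) ≫ δ.hom
      exact (congrArg (δ.hom ≫ ·) (CategoryTheory.Functor.map_id _ _)).trans
        ((Category.comp_id _).trans (Category.id_comp _).symm)
  have w : i ≫ p = 0 := F.map_injective (by
    rw [F.map_comp, F.map_zero]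
    exact comp_distTriang_mor_zero₁₂ _ hT')
  have hS := shortExact_of_map_distinguished (ShortComplex.mk i p w) δ.hom hT'
  refine ⟨X, i, p, w, hS, ?_⟩
  obtain ⟨c, hc₁, hc₂⟩ := complete_distinguished_triangle_morphism _ _
    hS.singleTriangle_distinguished hT' (𝟙 (F.obj K)) (𝟙 (F.obj X))
    ((Category.comp_id _).trans (Category.id_comp _).symm)
  obtain ⟨c, rfl⟩ := F.map_surjective c
  have := hS.epi_g
  have hc : c = 𝟙 Y := by
    rw [← cancel_epi p]
    apply F.map_injective
    have hc₁' : F.map p ≫ F.map c = 𝟙 (F.obj X) ≫ F.map p := hc₁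
    rw [F.map_comp, hc₁', Category.id_comp, Category.comp_id]
  subst hc
  ext
  rw [ShortComplex.ShortExact.extClass_hom]
  have hc₂' : hS.singleδ ≫ (𝟙 (F.obj K))⟦(1 : ℤ)⟧' = F.map (𝟙 Y) ≫ δ.hom := hc₂
  rw [CategoryTheory.Functor.map_id, F.map_id] at hc₂'
  exact (Category.comp_id _).symm.trans (hc₂'.trans (Category.id_comp _))

end ExtRepresentation

section AlmostSplit

open Abelian

variable [HasExt.{w} 𝒜]

lemma factorsThru_iff_comp_extClass_eq_zero {S : ShortComplex 𝒜} (hS : S.ShortExact)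
    {X : 𝒜} (h : X ⟶ S.X₃) :
    FactorsThru h S.g ↔ (Ext.mk₀ h).comp hS.extClass (zero_add 1) = 0 := by
  refine ⟨?_, fun hh => ?_⟩
  · rintro ⟨t, rfl⟩
    rw [← Ext.mk₀_comp_mk₀_assoc, hS.comp_extClass, Ext.comp_zero]
  · obtain ⟨x, hx⟩ := Ext.covariant_sequence_exact₃ X hS _ _ hh
    obtain ⟨t, rfl⟩ := Ext.mk₀_bijective _ _ |>.2 x
    rw [Ext.mk₀_comp_mk₀] at hx
    exact ⟨t, Ext.mk₀_bijective _ _ |>.1 hx⟩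

/-- The end terms of an almost split sequence carry a class `η` in the socle of every
`Ext¹`-group into the left-hand term and out of the right-hand term. -/
lemma ExistsAlmostSplitSeq.exists_class {A B : 𝒜} (hAB : ExistsAlmostSplitSeq A B) :
    ∃ η : Ext B A 1, η ≠ 0 ∧
      (∀ (Y : 𝒜) (ε : Ext Y A 1), ε ≠ 0 →
        ∃ f : B ⟶ Y, (Ext.mk₀ f).comp ε (zero_add 1) = η) ∧
      (∀ (Z : 𝒜) (δ : Ext B Z 1), δ ≠ 0 →
        ∃ a : Z ⟶ A, δ.comp (Ext.mk₀ a) (add_zero 1) = η) := by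
  obtain ⟨E, i, p, w, hS, hne, hpush, hpull⟩ := hAB
  refine ⟨hS.extClass, hne, fun Y ε hε => ?_, fun Z δ hδ => ?_⟩
  · obtain ⟨X, j, q, w', hS', rfl⟩ := exists_shortExact_extClass_eq ε
    have hj : ¬ IsSplitMono j := by
      rintro ⟨⟨r⟩⟩
      refine hε ?_
      rw [← Ext.comp_mk₀_id hS'.extClass, ← r.id, ← Ext.mk₀_comp_mk₀,
        ← Ext.comp_assoc_of_third_deg_zero, hS'.extClass_comp, Ext.zero_comp]
    obtain ⟨x, hx⟩ := Ext.covariant_sequence_exact₁ B hS' _ (hpush X j hj) (zero_add 1)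
    obtain ⟨f, rfl⟩ := Ext.mk₀_bijective _ _ |>.2 x
    exact ⟨f, hx⟩
  · obtain ⟨X, j, q, w', hS', rfl⟩ := exists_shortExact_extClass_eq δ
    have hq : ¬ IsSplitEpi q := by
      rintro ⟨⟨r⟩⟩
      refine hδ ?_
      rw [← Ext.mk₀_id_comp hS'.extClass, ← r.id, ← Ext.mk₀_comp_mk₀_assoc,
        hS'.comp_extClass, Ext.comp_zero]
    obtain ⟨x, hx⟩ := Ext.contravariant_sequence_exact₃ hS' A _ (hpull X q hq) (add_zero 1)
    obtain ⟨a, rfl⟩ := Ext.mk₀_bijective _ _ |>.2 x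
    exact ⟨a, hx⟩

end AlmostSplit

section Duality

open Abelian

variable {k : Type*} [Field k] [Linear k 𝒜] [HasExt.{w} 𝒜]

/-- Pullback of extension classes along `f`, as a linear map. -/
noncomputable def extPullback (k : Type*) [Field k] [Linear k 𝒜] {X Y : 𝒜} (f : X ⟶ Y) (A : 𝒜) :
    Ext Y A 1 →ₗ[k] Ext X A 1 where
  toFun e := (Ext.mk₀ f).comp e (zero_add 1)
  map_add' _ _ := Ext.comp_add ..
  map_smul' r e := by
    change (Ext.mk₀ f).comp ((Ext.mk₀ (r • 𝟙 Y)).comp e _) _ =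
      (Ext.mk₀ (r • 𝟙 X)).comp ((Ext.mk₀ f).comp e _) _
    simp only [Ext.mk₀_comp_mk₀_assoc, Linear.comp_smul, Linear.smul_comp, Category.comp_id,
      Category.id_comp]

/-- Pushout of extension classes along `a`, as a linear map. -/
noncomputable def extPushout (k : Type*) [Field k] [Linear k 𝒜] (X : 𝒜) {A B : 𝒜} (a : A ⟶ B) :
    Ext X A 1 →ₗ[k] Ext X B 1 where
  toFun e := e.comp (Ext.mk₀ a) (add_zero 1)
  map_add' _ _ := Ext.add_comp ..
  map_smul' _ _ := Ext.comp_assoc_of_third_deg_zero ..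

lemma extPullback_apply {X Y A : 𝒜} (f : X ⟶ Y) (e : Ext Y A 1) :
    extPullback k f A e = (Ext.mk₀ f).comp e (zero_add 1) := rfl

lemma extPushout_apply {X A B : 𝒜} (a : A ⟶ B) (e : Ext X A 1) :
    extPushout k X a e = e.comp (Ext.mk₀ a) (add_zero 1) := rfl

/-- The pairing `Hom(C, Y) × Ext¹(Y, T) → k` induced by a linear form on `Ext¹(C, T)`. -/
noncomputable def extPairing {C T : 𝒜} (φ : Module.Dual k (Ext C T 1)) (Y : 𝒜) :
    (C ⟶ Y) →ₗ[k] Module.Dual k (Ext Y T 1) where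
  toFun f := φ ∘ₗ extPullback k f T
  map_add' f g := by
    ext e
    simp only [LinearMap.comp_apply, LinearMap.add_apply, extPullback_apply, Ext.mk₀_add,
      Ext.add_comp, map_add]
  map_smul' r f := by
    ext e
    have h : extPullback k (r • f) T e = r • extPullback k f T e := by
      change _ = (Ext.mk₀ (r • 𝟙 C)).comp ((Ext.mk₀ f).comp e (zero_add 1)) (zero_add 1)
      rw [Ext.mk₀_comp_mk₀_assoc, Linear.smul_comp, Category.id_comp, extPullback_apply]
    simp only [LinearMap.comp_apply, LinearMap.smul_apply, h, map_smul, RingHom.id_apply]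

lemma extPairing_apply {C T Y : 𝒜} (φ : Module.Dual k (Ext C T 1)) (f : C ⟶ Y)
    (e : Ext Y T 1) : extPairing φ Y f e = φ ((Ext.mk₀ f).comp e (zero_add 1)) := rfl

/-- A linear form on `Ext¹(C, T)` whose pairings `Hom(C, Y) × Ext¹(Y, T) → k` have zero right
kernel and only projective morphisms in the left kernel. -/
structure IsDualizingForm {C T : 𝒜} (φ : Module.Dual k (Ext C T 1)) : Prop where
  eq_zero : ∀ {Y : 𝒜} (e : Ext Y T 1), (∀ f : C ⟶ Y, extPairing φ Y f e = 0) → e = 0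
  isProjMorphism : ∀ {Y : 𝒜} (f : C ⟶ Y), (∀ e, extPairing φ Y f e = 0) → IsProjMorphism f

lemma ExistsAlmostSplitSeq.exists_isDualizingForm {T C : 𝒜} (h : ExistsAlmostSplitSeq T C) :
    ∃ φ : Module.Dual k (Ext C T 1), IsDualizingForm φ := by
  obtain ⟨η, hη, hleft, hright⟩ := h.exists_class
  obtain ⟨φ, hφ⟩ : ∃ φ : Module.Dual k (Ext C T 1), φ η ≠ 0 := by
    by_contra! hφ
    exact hη ((Module.forall_dual_apply_eq_zero_iff k η).1 hφ)
  refine ⟨φ, fun {Y} e he => ?_, fun {Y} f hf A δ => ?_⟩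
  · by_contra hne
    obtain ⟨f, hf⟩ := hleft Y e hne
    exact hφ (by rw [← hf]; exact he f)
  · by_contra hne
    obtain ⟨a, ha⟩ := hright A _ hne
    refine hφ ?_
    rw [← ha, Ext.comp_assoc_of_third_deg_zero]
    exact hf _

lemma IsExtProjective.isDualizingForm_zero {T C : 𝒜} (hC : IsExtProjective C) (hT : IsZero T) :
    IsDualizingForm (0 : Module.Dual k (Ext C T 1)) where
  eq_zero {Y} e _ := by
    rw [← Ext.comp_mk₀_id e, hT.eq_of_src (𝟙 T) 0, Ext.mk₀_zero, Ext.comp_zero]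
  isProjMorphism {Y} f _ A δ := hC A _

lemma exists_isDualizingForm_biproduct {C : 𝒜} {n : ℕ} {Cf T : Fin n → 𝒜} (eC : C ≅ ⨁ Cf)
    (h : ∀ i, ∃ φ : Module.Dual k (Ext (Cf i) (T i) 1), IsDualizingForm φ) :
    ∃ φ : Module.Dual k (Ext C (⨁ T) 1), IsDualizingForm φ := by
  choose φ hφ using h
  let s (i : Fin n) : Cf i ⟶ C := biproduct.ι Cf i ≫ eC.inv
  let p (i : Fin n) : C ⟶ Cf i := eC.hom ≫ biproduct.π Cf i
  have hsp (i j : Fin n) : s i ≫ p j = if h : i = j then eqToHom (congrArg Cf h) else 0 := by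
    simp [s, p, biproduct.ι_π]
  have hps : ∑ i, p i ≫ s i = 𝟙 C := by
    have : ∑ i, p i ≫ s i = eC.hom ≫ (∑ i, biproduct.π Cf i ≫ biproduct.ι Cf i) ≫ eC.inv := by
      simp only [s, p, Preadditive.comp_sum, Preadditive.sum_comp, Category.assoc]
    rw [this, biproduct.total]
    simp
  let Φ : Module.Dual k (Ext C (⨁ T) 1) :=
    ∑ i, φ i ∘ₗ extPushout k (Cf i) (biproduct.π T i) ∘ₗ extPullback k (s i) (⨁ T)
  have hΦ {Y : 𝒜} (f : C ⟶ Y) (e : Ext Y (⨁ T) 1) : extPairing Φ Y f e =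
      ∑ i, extPairing (φ i) Y (s i ≫ f) (extPushout k Y (biproduct.π T i) e) := by
    simp only [extPairing_apply, Φ, LinearMap.sum_apply, LinearMap.comp_apply, extPushout_apply,
      extPullback_apply, Ext.mk₀_comp_mk₀_assoc, Ext.comp_assoc_of_third_deg_zero]
  refine ⟨Φ, fun {Y} e he => ?_, fun {Y} f hf A δ => ?_⟩
  · apply (Ext.addEquivBiproduct Y (biproduct.isBilimit T) 1).injective
    rw [map_zero]
    funext i
    refine (hφ i).eq_zero _ fun f => ?_
    have := he (p i ≫ f)
    rw [hΦ, Finset.sum_eq_single i] at this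
    · rw [← Category.assoc, hsp, dif_pos rfl, eqToHom_refl, Category.id_comp] at this
      exact this
    · intro j _ hj
      rw [← Category.assoc, hsp, dif_neg hj, zero_comp, map_zero, LinearMap.zero_apply]
    · simp
  · have hproj (i : Fin n) : IsProjMorphism (s i ≫ f) := by
      refine (hφ i).isProjMorphism _ fun e => ?_
      have := hf (extPushout k Y (biproduct.ι T i) e)
      rw [hΦ, Finset.sum_eq_single i] at this
      · simpa only [extPushout_apply, Ext.comp_assoc_of_third_deg_zero, Ext.mk₀_comp_mk₀,
          biproduct.ι_π_self, Ext.comp_mk₀_id] using this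
      · intro j _ hj
        rw [extPushout_apply, extPushout_apply, Ext.comp_assoc_of_third_deg_zero,
          Ext.mk₀_comp_mk₀, biproduct.ι_π_ne T hj.symm, Ext.mk₀_zero, Ext.comp_zero, map_zero]
      · simp
    have hf' : f = ∑ i, p i ≫ s i ≫ f := by
      simp only [← Category.assoc, ← Preadditive.sum_comp, hps, Category.id_comp]
    rw [hf', Ext.mk₀_sum, Ext.sum_comp]
    refine Finset.sum_eq_zero fun i _ => ?_
    rw [← Ext.mk₀_comp_mk₀_assoc, hproj i, Ext.comp_zero]

/-- A submodule of `Hom(C, Y)` containing the left kernel of the pairing is determined by its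
orthogonal in `Ext¹(Y, T)`. -/
lemma mem_iff_forall_mem_dualCoannihilator {V W : Type*} [AddCommGroup V] [Module k V]
    [AddCommGroup W] [Module k W] [FiniteDimensional k W] (B : V →ₗ[k] Module.Dual k W)
    (H : Submodule k V) (hH : LinearMap.ker B ≤ H) (v : V) :
    v ∈ H ↔ ∀ w ∈ (H.map B).dualCoannihilator, B v w = 0 := by
  rw [← Submodule.mem_dualAnnihilator, Subspace.dualCoannihilator_dualAnnihilator_eq,
    ← Submodule.mem_comap, Submodule.comap_map_eq, sup_eq_left.2 hH]

lemma IsDualizingForm.exists_shortExact {C T : 𝒜} {φ : Module.Dual k (Ext C T 1)}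
    (hφ : IsDualizingForm φ) {Y : 𝒜} [FiniteDimensional k (Ext Y T 1)]
    (H : AddSubgroup (C ⟶ Y)) (hH : ∀ h ∈ H, ∀ g : C ⟶ C, g ≫ h ∈ H)
    (hproj : ∀ f : C ⟶ Y, IsProjMorphism f → f ∈ H) :
    ∃ (m : ℕ) (X : 𝒜) (ι : (⨁ fun _ : Fin m => T) ⟶ X) (α : X ⟶ Y) (w : ι ≫ α = 0)
      (_ : (ShortComplex.mk ι α w).ShortExact),
      RightDetermined C α ∧ ∀ h : C ⟶ Y, h ∈ H ↔ FactorsThru h α := by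
  let Hk : Submodule k (C ⟶ Y) :=
    { H with smul_mem' := fun r h hh => by simpa using hH h hh (r • 𝟙 C) }
  have hker : LinearMap.ker (extPairing φ Y) ≤ Hk := fun f hf =>
    hproj f (hφ.isProjMorphism f fun e => LinearMap.congr_fun hf e)
  let V := (Hk.map (extPairing φ Y)).dualCoannihilator
  have hmem (h : C ⟶ Y) : h ∈ H ↔ ∀ e ∈ V, extPairing φ Y h e = 0 :=
    mem_iff_forall_mem_dualCoannihilator (extPairing φ Y) Hk hker h
  obtain ⟨m, d, hd⟩ := Submodule.fg_iff_exists_fin_generating_family.1 (IsNoetherian.noetherian V)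
  let E (Z : 𝒜) := Ext.addEquivBiproduct Z (biproduct.isBilimit fun _ : Fin m => T) 1
  obtain ⟨X, ι, α, w, hS, hδ⟩ := exists_shortExact_extClass_eq ((E Y).symm d)
  have hfac {Z : 𝒜} (g : Z ⟶ Y) :
      FactorsThru g α ↔ ∀ j, (Ext.mk₀ g).comp (d j) (zero_add 1) = 0 := by
    refine (factorsThru_iff_comp_extClass_eq_zero hS g).trans ?_
    rw [hδ, ← (E Z).map_eq_zero_iff, funext_iff]
    refine forall_congr' fun j => ?_
    have hj : ((E Y).symm d).comp (Ext.mk₀ (biproduct.π (fun _ : Fin m => T) j)) (add_zero 1) =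
        d j := congrFun ((E Y).apply_symm_apply d) j
    rw [← hj, ← Ext.comp_assoc_of_third_deg_zero]
    rfl
  refine ⟨m, X, ι, α, w, hS, fun Z g hg => ?_, fun h => ?_⟩
  · rw [hfac]
    refine fun j => hφ.eq_zero _ fun f => ?_
    rw [extPairing_apply, Ext.mk₀_comp_mk₀_assoc, (hfac _).1 (hg f) j, map_zero]
  · rw [hfac]
    refine ⟨fun hh j => hφ.eq_zero _ fun g => ?_, fun hh => (hmem h).2 fun e he => ?_⟩
    · rw [extPairing_apply, Ext.mk₀_comp_mk₀_assoc]
      exact (hmem _).1 (hH h hh g) (d j) (hd ▸ Submodule.subset_span ⟨j, rfl⟩)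
    · have : V ≤ LinearMap.ker (extPairing φ Y h) := by
        rw [← hd, Submodule.span_le]
        rintro _ ⟨j, rfl⟩
        change φ ((Ext.mk₀ h).comp (d j) (zero_add 1)) = 0
        rw [hh j, map_zero]
      exact this he

end Duality

/-- the existence theorem for right `C`-determined epimorphisms with
prescribed image submodule `H`. -/
theorem statement_14 {k : Type*} [Field k] [Linear k 𝒜] [HasExt.{w} 𝒜]
    (homFin : ∀ A B : 𝒜, FiniteDimensional k (A ⟶ B))
    (extFin : ∀ A B : 𝒜, FiniteDimensional k (Abelian.Ext A B 1))
    (hKS : IsKrullSchmidtCat 𝒜)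
    {C : 𝒜} (n : ℕ) (Cf T : Fin n → 𝒜) (eC : C ≅ ⨁ Cf)
    (hind : ∀ i, Indec (Cf i))
    (hT : ∀ i, (IsExtProjective (Cf i) ∧ IsZero (T i)) ∨ ExistsAlmostSplitSeq (T i) (Cf i)) :
    ∀ (Y : 𝒜) (H : AddSubgroup (C ⟶ Y)),
      (∀ h ∈ H, ∀ g : C ⟶ C, g ≫ h ∈ H) →
      (∀ f : C ⟶ Y, IsProjMorphism f → f ∈ H) →
      ∃ (K X : 𝒜) (ι : K ⟶ X) (α : X ⟶ Y) (w : ι ≫ α = 0)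
        (_ : (ShortComplex.mk ι α w).ShortExact),
        RightDetermined C α ∧
        (∃ m : ℕ, IsDirectSummand K (⨁ fun _ : Fin m => ⨁ T)) ∧
        (∀ h : C ⟶ Y, h ∈ H ↔ FactorsThru h α) := by
  intro Y H hH hproj
  have := extFin Y (⨁ T)
  obtain ⟨φ, hφ⟩ := exists_isDualizingForm_biproduct (k := k) eC fun i =>
    (hT i).elim (fun h => ⟨0, h.1.isDualizingForm_zero h.2⟩) fun h => h.exists_isDualizingForm
  obtain ⟨m, X, ι, α, w, hS, hdet, hfac⟩ := hφ.exists_shortExact H hH hproj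
  exact ⟨_, X, ι, α, w, hS, hdet, ⟨m, 𝟙 _, 𝟙 _, Category.id_comp _⟩, hfac⟩
end

section
/- Let k be a field and 𝒜 a k-linear Hom-finite, Ext-finite and Krull–Schmidt abelian category, and let C be an object of 𝒜. Suppose that for every object Y and every right End(C)-submodule H of Hom(C,Y) containing all projective morphisms C → Y, there exists a right C-determined epimorphism α: X → Y with H = {h ∈ Hom(C,Y) : h factors through α}. Then every non-projective indecomposable direct summand C' of C is the end term of an almost split short exact sequence 0 → K → E → C' → 0. -/
/- Preliminary definitions: the abelian-category instance of the extriangulated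
notions of the paper (s-projective/injective morphisms and objects, almost split
short exact sequences, morphisms determined by objects, etc.). -/

open CategoryTheory CategoryTheory.Limits

attribute [local instance] CategoryTheory.Abelian.hasFiniteBiproducts

universe w v u

variable {𝒜 : Type u} [Category.{v} 𝒜] [Abelian 𝒜]

section Helpers

/-- A nonzero retract of an indecomposable object is isomorphic to it. -/
lemma Indec.nonempty_iso_of_retract {X Y : 𝒜} (hX : Indec X) (hY : ¬ IsZero Y)
    (i : Y ⟶ X) (r : X ⟶ Y) (hir : i ≫ r = 𝟙 Y) : Nonempty (X ≅ Y) := by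
  have : IsSplitMono i := ⟨⟨⟨r, hir⟩⟩⟩
  let S := ShortComplex.mk i (cokernel.π i) (cokernel.condition i)
  have hS : S.Exact := S.exact_of_g_is_cokernel (cokernelIsCokernel i)
  have : Epi S.g := inferInstanceAs (Epi (cokernel.π i))
  let s : S.Splitting := .ofExactOfRetraction S hS r hir this
  have hQ : IsZero S.X₃ :=
    (hX.2 Y S.X₃ ⟨s.isoBinaryBiproduct⟩).resolve_left hY
  have : Epi i := Abelian.epi_of_cokernel_π_eq_zero i (hQ.eq_of_tgt _ _)
  have : IsIso i := isIso_of_epi_of_isSplitMono i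
  exact ⟨(asIso i).symm⟩

lemma not_isZero_of_isLocalRing_end {X : 𝒜} (h : IsLocalRing (End X)) : ¬ IsZero X :=
  fun h0 => zero_ne_one (α := End X) (h0.eq_of_src _ _)

lemma isLocalRing_end_of_iso {X Y : 𝒜} (e : X ≅ Y) (h : IsLocalRing (End Y)) :
    IsLocalRing (End X) :=
  have : Nontrivial (End X) :=
    ⟨0, 1, fun h01 => not_isZero_of_isLocalRing_end h
      (((IsZero.iff_id_eq_zero X).2 h01.symm).of_iso e.symm)⟩
  let φ : End X ≃+* End Y :=
    { e.conj with
      map_add' := fun f g =>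
        (congrArg (e.inv ≫ ·) (Preadditive.add_comp _ _ _ f g e.hom)).trans
          (Preadditive.comp_add _ _ _ e.inv (f ≫ e.hom) (g ≫ e.hom)) }
  { isUnit_or_isUnit_of_add_one := fun {a b} hab =>
      (IsLocalRing.isUnit_or_isUnit_of_add_one
        ((map_add φ a b).symm.trans ((congrArg φ hab).trans (map_one φ)))).imp
        (MulEquiv.isUnit_map φ).1 (MulEquiv.isUnit_map φ).1 }

lemma Indec.isLocalRing_end (hKS : IsKrullSchmidtCat 𝒜) {X : 𝒜} (hX : Indec X) :
    IsLocalRing (End X) := by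
  obtain ⟨n, Z, ⟨e⟩, hZ⟩ := hKS X
  rcases n with - | n
  · refine absurd ((IsZero.iff_id_eq_zero X).2 ?_) hX.1
    rw [← cancel_mono e.hom]
    ext j
    exact j.elim0
  · obtain ⟨e'⟩ := hX.nonempty_iso_of_retract (not_isZero_of_isLocalRing_end (hZ 0))
      (biproduct.ι Z 0 ≫ e.inv) (e.hom ≫ biproduct.π Z 0) (by simp)
    exact isLocalRing_end_of_iso e' (hZ 0)

/-- For `Y` with local endomorphism ring, the morphisms `X ⟶ Y` which are not split
epimorphisms form a subgroup. -/
def radicalHom (X Y : 𝒜) [IsLocalRing (End Y)] : AddSubgroup (X ⟶ Y) where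
  carrier := {h | ¬ IsSplitEpi h}
  zero_mem' := by
    rintro ⟨⟨s, hs⟩⟩
    exact zero_ne_one (α := End Y) (comp_zero.symm.trans hs)
  add_mem' := by
    rintro a b ha hb ⟨⟨s, hs⟩⟩
    rw [Preadditive.comp_add] at hs
    rcases IsLocalRing.isUnit_or_isUnit_of_add_one (R := End Y) hs with h | h <;>
      have := (isUnit_iff_isIso _).1 h
    · exact ha ⟨⟨inv (s ≫ a) ≫ s, by rw [Category.assoc, IsIso.inv_hom_id]⟩⟩
    · exact hb ⟨⟨inv (s ≫ b) ≫ s, by rw [Category.assoc, IsIso.inv_hom_id]⟩⟩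
  neg_mem' := by
    rintro a ha ⟨⟨s, hs⟩⟩
    exact ha ⟨⟨-s, by simpa using hs⟩⟩

omit [Abelian 𝒜] in
/-- If the morphisms `C ⟶ Y` which are not split epimorphisms are those factoring through
a right `C`-determined `α`, and `Y` is a summand of `C`, then `α` is right almost split. -/
lemma RightDetermined.rightAlmostSplit {C X Y : 𝒜} {α : X ⟶ Y} (hα : RightDetermined C α)
    (hY : IsDirectSummand Y C) (h : ∀ f : C ⟶ Y, ¬ IsSplitEpi f ↔ FactorsThru f α) :
    RightAlmostSplit α := by
  obtain ⟨i, r, hir⟩ := hY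
  refine ⟨fun ⟨⟨s, hs⟩⟩ => (h r).2 ⟨r ≫ s, by simp [hs]⟩ ⟨⟨i, hir⟩⟩, fun T g hg => ?_⟩
  refine hα T g fun f => (h _).1 fun ⟨⟨s, hs⟩⟩ => hg ⟨⟨s ≫ f, by simpa using hs⟩⟩

/-- The pushout of a short exact sequence along a morphism out of its first term. -/
lemma CategoryTheory.ShortComplex.ShortExact.exists_pushout {S : ShortComplex 𝒜}
    (hS : S.ShortExact) {A : 𝒜} (a : S.X₁ ⟶ A) :
    ∃ (E : 𝒜) (i : A ⟶ E) (p : E ⟶ S.X₃) (w : i ≫ p = 0) (b : S.X₂ ⟶ E),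
      (ShortComplex.mk i p w).ShortExact ∧ S.f ≫ b = a ≫ i ∧ b ≫ p = S.g := by
  have := hS.mono_f
  have := hS.epi_g
  let p : pushout S.f a ⟶ S.X₃ := pushout.desc S.g 0 (by simp)
  have hb : pushout.inl S.f a ≫ p = S.g := pushout.inl_desc _ _ _
  have w : pushout.inr S.f a ≫ p = 0 := pushout.inr_desc _ _ _
  have hp : Epi p := epi_of_epi_fac hb
  refine ⟨_, pushout.inr S.f a, p, w, pushout.inl S.f a,
    { exact := ShortComplex.exact_of_g_is_cokernel _ ?_
      mono_f := inferInstanceAs (Mono (pushout.inr S.f a))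
      epi_g := hp }, pushout.condition, hb⟩
  have key {Z : 𝒜} (k : pushout S.f a ⟶ Z) (hk : pushout.inr S.f a ≫ k = 0) :
      S.f ≫ pushout.inl S.f a ≫ k = 0 := by
    rw [pushout.condition_assoc, hk, comp_zero]
  refine CokernelCofork.IsColimit.ofπ p w (fun k hk => hS.exact.desc _ (key k hk)) ?_ ?_
  · intro Z k hk
    apply pushout.hom_ext
    · rw [reassoc_of% hb]
      exact hS.exact.g_desc _ _
    · rw [reassoc_of% w, hk, zero_comp]
  · intro Z k hk m hm
    rw [← cancel_epi p, hm]
    apply pushout.hom_ext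
    · rw [reassoc_of% hb]
      exact (hS.exact.g_desc _ _).symm
    · rw [reassoc_of% w, hk, zero_comp]

variable [HasExt.{w} 𝒜]

/-- Every pushout of the class of a short exact sequence is the class of a short exact
sequence. -/
lemma CategoryTheory.ShortComplex.ShortExact.exists_extClass_eq_comp {S : ShortComplex 𝒜}
    (hS : S.ShortExact) {A : 𝒜} (a : S.X₁ ⟶ A) :
    ∃ (E : 𝒜) (i : A ⟶ E) (p : E ⟶ S.X₃) (w : i ≫ p = 0)
      (hT : (ShortComplex.mk i p w).ShortExact),
      hT.extClass = hS.extClass.comp (Abelian.Ext.mk₀ a) (add_zero 1) := by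
  obtain ⟨E, i, p, w, b, hT, h₁, h₂⟩ := hS.exists_pushout a
  refine ⟨E, i, p, w, hT, ?_⟩
  let φ : S ⟶ ShortComplex.mk i p w :=
    { τ₁ := a
      τ₂ := b
      τ₃ := 𝟙 _
      comm₁₂ := h₁.symm
      comm₂₃ := by simpa using h₂ }
  have := ShortComplex.ShortExact.extClass_naturality hS hT φ
  rw [this, Abelian.Ext.mk₀_id_comp]

/-- A short exact sequence splits when its class vanishes. -/
lemma CategoryTheory.ShortComplex.ShortExact.isSplitEpi_of_extClass_eq_zero
    {S : ShortComplex 𝒜} (hS : S.ShortExact) (h : hS.extClass = 0) : IsSplitEpi S.g := by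
  obtain ⟨s, hs⟩ := Abelian.Ext.covariant_sequence_exact₃ S.X₃ hS (Abelian.Ext.mk₀ (𝟙 _))
    (zero_add 1) (by rw [h, Abelian.Ext.comp_zero])
  obtain ⟨s, rfl⟩ := Abelian.Ext.addEquiv₀.symm.surjective s
  refine ⟨⟨s, (Abelian.Ext.mk₀_bijective S.X₃ S.X₃).1 ?_⟩⟩
  simpa using hs

lemma CategoryTheory.ShortComplex.ShortExact.not_isSplitEpi_of_extClass_ne_zero
    {S : ShortComplex 𝒜} (hS : S.ShortExact) (h : hS.extClass ≠ 0) : ¬ IsSplitEpi S.g := by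
  rintro ⟨⟨s, hs⟩⟩
  apply h
  rw [← Abelian.Ext.mk₀_id_comp hS.extClass, ← hs, ← Abelian.Ext.mk₀_comp_mk₀_assoc,
    hS.comp_extClass, Abelian.Ext.comp_zero]

/-- A nonzero element of `Ext` has a nonzero component along some biproduct summand. -/
lemma exists_comp_biproduct_π_ne_zero {A X : 𝒜} {m n : ℕ} {Z : Fin n → 𝒜} (e : X ≅ ⨁ Z)
    (η : Abelian.Ext A X m) (hη : η ≠ 0) :
    ∃ j, η.comp (Abelian.Ext.mk₀ (e.hom ≫ biproduct.π Z j)) (add_zero m) ≠ 0 := by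
  by_contra! h
  have hid : 𝟙 X = ∑ j, (e.hom ≫ biproduct.π Z j) ≫ biproduct.ι Z j ≫ e.inv :=
    calc 𝟙 X = e.hom ≫ (∑ j, biproduct.π Z j ≫ biproduct.ι Z j) ≫ e.inv := by
          rw [biproduct.total, Category.id_comp, e.hom_inv_id]
      _ = _ := by simp only [Preadditive.comp_sum, Preadditive.sum_comp, Category.assoc]
  apply hη
  rw [← Abelian.Ext.comp_mk₀_id η, hid, Abelian.Ext.mk₀_sum, Abelian.Ext.comp_sum]
  refine Finset.sum_eq_zero fun j _ => ?_
  rw [← Abelian.Ext.mk₀_comp_mk₀, ← Abelian.Ext.comp_assoc_of_third_deg_zero, h j,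
    Abelian.Ext.zero_comp]

/-- A nonsplit short exact sequence whose first term has local endomorphism ring is almost
split as soon as its class is killed by pullback along every non-retraction. -/
lemma isAlmostSplitSeq_of_isLocalRing_end {S : ShortComplex 𝒜} (hS : S.ShortExact)
    (hloc : IsLocalRing (End S.X₁)) (h0 : hS.extClass ≠ 0)
    (hr : ∀ (Y' : 𝒜) (c : Y' ⟶ S.X₃), ¬ IsSplitEpi c →
      (Abelian.Ext.mk₀ c).comp hS.extClass (zero_add 1) = 0) :
    IsAlmostSplitSeq hS := by
  refine ⟨h0, fun X' a ha => ?_, hr⟩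
  by_contra hne
  obtain ⟨E, i, p, w, hT, hTa⟩ := hS.exists_extClass_eq_comp a
  rw [← hTa] at hne
  obtain ⟨b, hb⟩ := Abelian.Ext.contravariant_sequence_exact₃ hT S.X₁ hS.extClass
    (hr E p (hT.not_isSplitEpi_of_extClass_ne_zero hne)) (add_zero 1)
  obtain ⟨b, rfl⟩ := Abelian.Ext.addEquiv₀.symm.surjective b
  have hab : hS.extClass.comp (Abelian.Ext.mk₀ (a ≫ b)) (add_zero 1) = hS.extClass := by
    rw [← Abelian.Ext.mk₀_comp_mk₀, ← Abelian.Ext.comp_assoc_of_third_deg_zero, ← hTa]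
    exact hb
  rcases IsLocalRing.isUnit_or_isUnit_of_add_one (R := End S.X₁)
    (a := a ≫ b) (b := 𝟙 S.X₁ - a ≫ b) (add_sub_cancel (a ≫ b) (𝟙 S.X₁)) with h | h <;> have := (isUnit_iff_isIso _).1 h
  · exact ha ⟨⟨b ≫ inv (a ≫ b), by rw [← Category.assoc, IsIso.hom_inv_id]⟩⟩
  · set d : S.X₁ ⟶ S.X₁ := 𝟙 S.X₁ - a ≫ b
    have hsum : 𝟙 S.X₁ = a ≫ b + d := (add_sub_cancel (a ≫ b) (𝟙 S.X₁)).symm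
    have hd0 : hS.extClass.comp (Abelian.Ext.mk₀ d) (add_zero 1) = 0 := by
      have := Abelian.Ext.comp_mk₀_id hS.extClass
      rw [hsum, Ext_mk₀_add, Abelian.Ext.comp_add, hab] at this
      exact left_eq_add.1 this.symm
    apply h0
    rw [← Abelian.Ext.comp_mk₀_id hS.extClass, ← IsIso.hom_inv_id d,
      ← Abelian.Ext.mk₀_comp_mk₀, ← Abelian.Ext.comp_assoc_of_third_deg_zero, hd0,
      Abelian.Ext.zero_comp]

/-- In a Krull–Schmidt abelian category, the target of a right almost split epimorphism is
the end term of an almost split sequence. -/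
lemma RightAlmostSplit.existsAlmostSplitEndingAt (hKS : IsKrullSchmidtCat 𝒜) {X Y : 𝒜}
    {α : X ⟶ Y} [Epi α] (hα : RightAlmostSplit α) : ExistsAlmostSplitEndingAt Y := by
  let S := ShortComplex.mk (kernel.ι α) α (kernel.condition α)
  have hS : S.ShortExact :=
    { exact := S.exact_of_f_is_kernel (kernelIsKernel α)
      mono_f := inferInstanceAs (Mono (kernel.ι α))
      epi_g := inferInstanceAs (Epi α) }
  have hη : hS.extClass ≠ 0 := fun h => hα.1 (hS.isSplitEpi_of_extClass_eq_zero h)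
  obtain ⟨n, Z, ⟨e⟩, hZ⟩ := hKS S.X₁
  obtain ⟨j, hj⟩ := exists_comp_biproduct_π_ne_zero e _ hη
  obtain ⟨E, i, p, w, hT, hTj⟩ := hS.exists_extClass_eq_comp (e.hom ≫ biproduct.π Z j)
  refine ⟨Z j, E, i, p, w, hT,
    isAlmostSplitSeq_of_isLocalRing_end hT (hZ j) (hTj ▸ hj) fun Y' c hc => ?_⟩
  obtain ⟨t, rfl⟩ := hα.2 Y' c hc
  have hg : (Abelian.Ext.mk₀ α).comp hS.extClass (zero_add 1) = 0 := hS.comp_extClass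
  rw [hTj, ← Abelian.Ext.mk₀_comp_mk₀_assoc, ← Abelian.Ext.comp_assoc_of_third_deg_zero,
    hg, Abelian.Ext.zero_comp, Abelian.Ext.comp_zero]

/-- The target of a projective split epimorphism is projective. -/
lemma IsProjMorphism.isExtProjective_of_isSplitEpi {X Y : 𝒜} {f : X ⟶ Y}
    (hf : IsProjMorphism f) [IsSplitEpi f] : IsExtProjective Y := fun A δ => by
  rw [← Abelian.Ext.mk₀_id_comp δ, ← IsSplitEpi.id f, ← Abelian.Ext.mk₀_comp_mk₀_assoc,
    hf A δ, Abelian.Ext.comp_zero]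

end Helpers

/-- the converse of the existence theorem: realizability of all
submodules `H` by right `C`-determined epimorphisms forces almost split sequences
ending at the non-projective indecomposable direct summands of `C`. -/
theorem statement_15 {k : Type*} [Field k] [Linear k 𝒜] [HasExt.{w} 𝒜]
    (homFin : ∀ A B : 𝒜, FiniteDimensional k (A ⟶ B))
    (extFin : ∀ A B : 𝒜, FiniteDimensional k (Abelian.Ext A B 1))
    (hKS : IsKrullSchmidtCat 𝒜) (C : 𝒜)
    (hyp : ∀ (Y : 𝒜) (H : AddSubgroup (C ⟶ Y)),
      (∀ h ∈ H, ∀ g : C ⟶ C, g ≫ h ∈ H) →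
      (∀ f : C ⟶ Y, IsProjMorphism f → f ∈ H) →
      ∃ (X : 𝒜) (α : X ⟶ Y), Epi α ∧ RightDetermined C α ∧
        ∀ h : C ⟶ Y, h ∈ H ↔ FactorsThru h α) :
    ∀ C' : 𝒜, IsDirectSummand C' C → Indec C' → ¬ IsExtProjective C' →
      ExistsAlmostSplitEndingAt C' := by
  intro C' hC' hind hnp
  have := hind.isLocalRing_end hKS
  obtain ⟨X, α, _, hdet, hH⟩ := hyp C' (radicalHom C C')
    (fun h hh g ⟨⟨s, hs⟩⟩ => hh ⟨⟨s ≫ g, by simpa using hs⟩⟩)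
    (fun f hf _ => hnp hf.isExtProjective_of_isSplitEpi)
  exact (hdet.rightAlmostSplit hC' hH).existsAlmostSplitEndingAt hKS
end

section
/- Let k be a field and 𝒜 a k-linear Hom-finite, Ext-finite and Krull–Schmidt abelian category. Let α: X → Y be an epimorphism and let α': X' → Y be a right minimal epimorphism such that α factors through α' and α' factors through α (a right minimal version of α), with kernel K' = ker α'. Then α is right C-determined for some object C if and only if every indecomposable direct summand of K' is either injective or the first term of an almost split short exact sequence. -/
/- Preliminary definitions: the abelian-category instance of the extriangulated
notions of the paper (s-projective/injective morphisms and objects, almost split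
short exact sequences, morphisms determined by objects, etc.). -/

open CategoryTheory CategoryTheory.Limits

attribute [local instance] CategoryTheory.Abelian.hasFiniteBiproducts

universe w v u

variable {𝒜 : Type u} [Category.{v} 𝒜] [Abelian 𝒜]

open CategoryTheory.Abelian

lemma isIso_or_isIso_of_add_eq_id {Z : 𝒜} [IsLocalRing (End Z)] {f g : Z ⟶ Z}
    (h : f + g = 𝟙 Z) : IsIso f ∨ IsIso g :=
  (IsLocalRing.isUnit_or_isUnit_of_add_one (R := End Z) (a := f) (b := g) h).imp
    (isUnit_iff_isIso (X := Z) f).1 (isUnit_iff_isIso (X := Z) g).1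

lemma not_isSplitMono_biprod_lift {Z A B : 𝒜} [IsLocalRing (End Z)] {a : Z ⟶ A} {b : Z ⟶ B}
    (ha : ¬ IsSplitMono a) (hb : ¬ IsSplitMono b) : ¬ IsSplitMono (biprod.lift a b) := by
  rintro ⟨⟨s, hs⟩⟩
  have h : a ≫ biprod.inl ≫ s + b ≫ biprod.inr ≫ s = 𝟙 Z := by
    rw [← hs, biprod.lift_eq, Preadditive.add_comp, Category.assoc, Category.assoc]
  rcases isIso_or_isIso_of_add_eq_id h with _ | _
  · exact ha ⟨⟨(biprod.inl ≫ s) ≫ inv (a ≫ biprod.inl ≫ s), by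
      rw [← Category.assoc, IsIso.hom_inv_id]⟩⟩
  · exact hb ⟨⟨(biprod.inr ≫ s) ≫ inv (b ≫ biprod.inr ≫ s), by
      rw [← Category.assoc, IsIso.hom_inv_id]⟩⟩

lemma sum_biproduct_decomposition {n : ℕ} {Z : Fin n → 𝒜} {X : 𝒜} (φ : X ≅ ⨁ Z) :
    ∑ j, (φ.hom ≫ biproduct.π Z j) ≫ (biproduct.ι Z j ≫ φ.inv) = 𝟙 X := by
  have h : ∑ j, (φ.hom ≫ biproduct.π Z j) ≫ (biproduct.ι Z j ≫ φ.inv) =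
      φ.hom ≫ (∑ j, biproduct.π Z j ≫ biproduct.ι Z j) ≫ φ.inv := by
    simp only [Preadditive.sum_comp, Preadditive.comp_sum, Category.assoc]
  rw [h, biproduct.total, Category.id_comp, φ.hom_inv_id]

lemma FactorsThru.trans {T X X' Y : 𝒜} {g : T ⟶ Y} {f : X ⟶ Y} {f' : X' ⟶ Y}
    (hg : FactorsThru g f) (hf : FactorsThru f f') : FactorsThru g f' := by
  obtain ⟨t, rfl⟩ := hg
  obtain ⟨s, rfl⟩ := hf
  exact ⟨t ≫ s, by simp⟩

lemma RightDetermined.congr {C X X' Y : 𝒜} {f : X ⟶ Y} {f' : X' ⟶ Y} (hf : RightDetermined C f)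
    (h : FactorsThru f f') (h' : FactorsThru f' f) : RightDetermined C f' :=
  fun T g hg => (hf T g fun c => (hg c).trans h').trans h

lemma nonempty_iso_biprod_of_retract {X Z : 𝒜} (i : Z ⟶ X) (r : X ⟶ Z) (h : i ≫ r = 𝟙 Z) :
    Nonempty (X ≅ Z ⊞ cokernel i) := by
  have : Mono i := mono_of_mono_fac h
  have hS : (ShortComplex.mk i (cokernel.π i) (cokernel.condition i)).ShortExact :=
    { exact := ShortComplex.exact_cokernel i, mono_f := ‹_›, epi_g := inferInstance }
  exact ⟨(ShortComplex.Splitting.ofExactOfRetraction _ hS.exact r h hS.epi_g).isoBinaryBiproduct⟩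

lemma indec_of_isLocalRing_end (Z : 𝒜) [IsLocalRing (End Z)] : Indec Z := by
  refine ⟨fun hz => one_ne_zero (α := End Z) ((IsZero.iff_id_eq_zero Z).1 hz), ?_⟩
  rintro A B ⟨φ⟩
  have hsum : φ.hom ≫ (biprod.fst ≫ biprod.inl) ≫ φ.inv +
      φ.hom ≫ (biprod.snd ≫ biprod.inr) ≫ φ.inv = 𝟙 Z := by
    rw [← Preadditive.comp_add, ← Preadditive.add_comp, biprod.total]
    simp
  rcases isIso_or_isIso_of_add_eq_id hsum with _ | _
  · right
    have h0 : biprod.inr ≫ φ.inv = 0 := by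
      rw [← cancel_mono (φ.hom ≫ (biprod.fst ≫ biprod.inl) ≫ φ.inv)]
      simp
    rw [IsZero.iff_id_eq_zero, ← biprod.inr_snd (X := A) (Y := B), ← Category.comp_id biprod.inr,
      ← φ.inv_hom_id, reassoc_of% h0]
    simp
  · left
    have h0 : biprod.inl ≫ φ.inv = 0 := by
      rw [← cancel_mono (φ.hom ≫ (biprod.snd ≫ biprod.inr) ≫ φ.inv)]
      simp
    rw [IsZero.iff_id_eq_zero, ← biprod.inl_fst (X := A) (Y := B), ← Category.comp_id biprod.inl,
      ← φ.inv_hom_id, reassoc_of% h0]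
    simp

lemma isLocalRing_end_of_iso_s16 {Z W : 𝒜} (φ : W ≅ Z) [IsLocalRing (End W)] :
    IsLocalRing (End Z) := by
  have : Nontrivial (End Z) := φ.conj.injective.nontrivial
  have key (f g : Z ⟶ Z) (hfg : f + g = 𝟙 Z) :
      φ.hom ≫ f ≫ φ.inv + φ.hom ≫ g ≫ φ.inv = 𝟙 W := by
    rw [← Preadditive.comp_add, ← Preadditive.add_comp, hfg]
    simp
  refine .of_is_unit_or_is_unit_of_add_one fun {f g} hfg => ?_
  exact (isIso_or_isIso_of_add_eq_id (key f g hfg)).imp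
    (fun hf => (MulEquiv.isUnit_map φ.symm.conj).1 ((isUnit_iff_isIso (X := W) _).2 hf))
    (fun hg => (MulEquiv.isUnit_map φ.symm.conj).1 ((isUnit_iff_isIso (X := W) _).2 hg))

lemma isLocalRing_end_of_indec (hKS : IsKrullSchmidtCat 𝒜) {Z : 𝒜} (hZ : Indec Z) :
    IsLocalRing (End Z) := by
  obtain ⟨n, F, ⟨φ⟩, hF⟩ := hKS Z
  have hn : n ≠ 0 := by
    rintro rfl
    apply hZ.1
    rw [IsZero.iff_id_eq_zero, ← sum_biproduct_decomposition φ]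
    simp
  let j : Fin n := ⟨0, Nat.pos_of_ne_zero hn⟩
  have hj : (biproduct.ι F j ≫ φ.inv) ≫ (φ.hom ≫ biproduct.π F j) = 𝟙 _ := by simp
  obtain ⟨ψ⟩ := nonempty_iso_biprod_of_retract _ _ hj
  have := hF j
  rcases hZ.2 _ _ ⟨ψ⟩ with h0 | h0
  · exact absurd h0 (indec_of_isLocalRing_end _).1
  · exact isLocalRing_end_of_iso_s16 (ψ ≪≫ (Limits.isoBiprodZero h0).symm).symm

lemma not_isSplitMono_of_rightMinimal {X Y Z : 𝒜} {f : X ⟶ Y} (hf : RightMinimal f)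
    (hZ : ¬ IsZero Z) (i : Z ⟶ X) (hi : i ≫ f = 0) : ¬ IsSplitMono i := by
  rintro ⟨⟨s, hs⟩⟩
  have : IsIso (𝟙 X - s ≫ i) := hf _ (by simp [Preadditive.sub_comp, hi])
  have hi₀ : i = 0 := by
    rw [← cancel_mono (𝟙 X - s ≫ i), Preadditive.comp_sub, reassoc_of% hs]
    simp
  apply hZ
  rw [IsZero.iff_id_eq_zero, ← hs, hi₀, zero_comp]

section ExtensionClasses

variable [HasExt.{w} 𝒜]

/-- `e` is the class of some short exact sequence `0 ⟶ A ⟶ E ⟶ B ⟶ 0`. -/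
def IsExtensionClass {A B : 𝒜} (e : Ext B A 1) : Prop :=
  ∃ (E : 𝒜) (i : A ⟶ E) (p : E ⟶ B) (w : i ≫ p = 0)
    (hS : (ShortComplex.mk i p w).ShortExact), hS.extClass = e

lemma IsExtensionClass.precomp {A B B' : 𝒜} {e : Ext B A 1} (he : IsExtensionClass e)
    (c : B' ⟶ B) : IsExtensionClass ((Ext.mk₀ c).comp e (zero_add 1)) := by
  obtain ⟨E, i, p, w, hS, rfl⟩ := he
  have := hS.mono_f
  have := hS.epi_g
  dsimp at *
  have w' : pullback.lift i (0 : A ⟶ B') (by simp [w]) ≫ pullback.snd p c = 0 :=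
    pullback.lift_snd _ _ _
  have hmono : Mono (pullback.lift i (0 : A ⟶ B') (by simp [w]) : A ⟶ pullback p c) :=
    mono_of_mono_fac (pullback.lift_fst (f := p) (g := c) i 0 (by simp [w]))
  have hS' : (ShortComplex.mk _ (pullback.snd p c) w').ShortExact :=
    { exact := by
        refine ShortComplex.exact_of_f_is_kernel _ (KernelFork.IsLimit.ofι' _ _ fun {T} k hk => ?_)
        have hk' : k ≫ pullback.snd p c = 0 := hk
        have hk₀ : (k ≫ pullback.fst p c) ≫ p = 0 := by
          rw [Category.assoc, pullback.condition, reassoc_of% hk', zero_comp]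
        refine ⟨hS.exact.lift (k ≫ pullback.fst p c) hk₀, ?_⟩
        apply pullback.hom_ext
        · dsimp
          rw [Category.assoc, pullback.lift_fst]
          exact hS.exact.lift_f _ hk₀
        · dsimp
          rw [Category.assoc, pullback.lift_snd, comp_zero, hk']
      mono_f := hmono
      epi_g := by dsimp; infer_instance }
  refine ⟨_, _, _, w', hS', ?_⟩
  have := ShortComplex.ShortExact.extClass_naturality hS' hS
    { τ₁ := 𝟙 A, τ₂ := pullback.fst p c, τ₃ := c,
      comm₁₂ := (Category.id_comp i).trans (pullback.lift_fst _ _ _).symm,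
      comm₂₃ := pullback.condition }
  simpa using this

lemma IsExtensionClass.postcomp {A A' B : 𝒜} {e : Ext B A 1} (he : IsExtensionClass e)
    (a : A ⟶ A') : IsExtensionClass (e.comp (Ext.mk₀ a) (add_zero 1)) := by
  obtain ⟨E, i, p, w, hS, rfl⟩ := he
  have := hS.mono_f
  have := hS.epi_g
  dsimp at *
  have w' : pushout.inr i a ≫ pushout.desc p (0 : A' ⟶ B) (by simp [w]) = 0 :=
    pushout.inr_desc _ _ _
  have hepi : Epi (pushout.desc p (0 : A' ⟶ B) (by simp [w]) : pushout i a ⟶ B) :=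
    epi_of_epi_fac (pushout.inl_desc (f := i) (g := a) p 0 (by simp [w]))
  have hS' : (ShortComplex.mk (pushout.inr i a) _ w').ShortExact :=
    { exact := by
        refine ShortComplex.exact_of_g_is_cokernel _
          (CokernelCofork.IsColimit.ofπ' _ _ fun {T} k hk => ?_)
        have hk' : pushout.inr i a ≫ k = 0 := hk
        have hk₀ : i ≫ pushout.inl i a ≫ k = 0 := by
          rw [pushout.condition_assoc, hk', comp_zero]
        refine ⟨hS.exact.desc (pushout.inl i a ≫ k) hk₀, ?_⟩
        apply pushout.hom_ext
        · dsimp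
          rw [pushout.inl_desc_assoc]
          exact hS.exact.g_desc _ hk₀
        · dsimp
          rw [pushout.inr_desc_assoc, zero_comp, hk']
      mono_f := by dsimp; infer_instance
      epi_g := hepi }
  refine ⟨_, _, _, w', hS', ?_⟩
  have := ShortComplex.ShortExact.extClass_naturality hS hS'
    { τ₁ := a, τ₂ := pushout.inl i a, τ₃ := 𝟙 B, comm₁₂ := pushout.condition.symm,
      comm₂₃ := (pushout.inl_desc _ _ _).trans (Category.comp_id p).symm }
  simpa using this.symm

/-- `ε` is annihilated by pushing out along any morphism that is not a section. -/
def KilledByNonSections {Z W : 𝒜} (ε : Ext W Z 1) : Prop :=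
  ∀ (X' : 𝒜) (a : Z ⟶ X'), ¬ IsSplitMono a → ε.comp (Ext.mk₀ a) (add_zero 1) = 0

lemma KilledByNonSections.precomp {Z W W' : 𝒜} {ε : Ext W Z 1} (hε : KilledByNonSections ε)
    (c : W' ⟶ W) : KilledByNonSections ((Ext.mk₀ c).comp ε (zero_add 1)) := by
  intro X' a ha
  rw [Ext.comp_assoc_of_third_deg_zero, hε X' a ha, Ext.comp_zero]

lemma eq_zero_of_comp_isSplitMono {A B T : 𝒜} (x : Ext T A 1) (i : A ⟶ B) [IsSplitMono i]
    (h : x.comp (Ext.mk₀ i) (add_zero 1) = 0) : x = 0 := by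
  have : (x.comp (Ext.mk₀ i) (add_zero 1)).comp (Ext.mk₀ (retraction i)) (add_zero 1) = x := by
    rw [Ext.comp_assoc_of_third_deg_zero, Ext.mk₀_comp_mk₀, IsSplitMono.id, Ext.comp_mk₀_id]
  rw [← this, h, Ext.zero_comp]

/-- An extension killed by all non-sections is a pullback of every nonzero extension class with
the same kernel. -/
lemma KilledByNonSections.exists_precomp_eq {Z W T : 𝒜} {ε : Ext W Z 1}
    (hε : KilledByNonSections ε) {e : Ext T Z 1} (he : IsExtensionClass e) (hne : e ≠ 0) :
    ∃ h : W ⟶ T, (Ext.mk₀ h).comp e (zero_add 1) = ε := by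
  obtain ⟨E, i, p, w, hS, rfl⟩ := he
  have hi : ¬ IsSplitMono i := fun _ =>
    hne (eq_zero_of_comp_isSplitMono _ i hS.extClass_comp)
  obtain ⟨x, hx⟩ := Ext.covariant_sequence_exact₁ W hS ε (hε _ i hi) (zero_add 1)
  obtain ⟨h, rfl⟩ := (Ext.mk₀_bijective _ _).2 x
  exact ⟨h, hx⟩

lemma existsAlmostSplitSeq_of_killedByNonSections {Z W : 𝒜} [IsLocalRing (End W)]
    {ε : Ext W Z 1} (hr : IsExtensionClass ε) (hne : ε ≠ 0) (hε : KilledByNonSections ε) :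
    ExistsAlmostSplitSeq Z W := by
  have key : ∀ (Y' : 𝒜) (c : Y' ⟶ W), ¬ IsSplitEpi c →
      (Ext.mk₀ c).comp ε (zero_add 1) = 0 := by
    intro Y' c hc
    by_contra hcε
    obtain ⟨h, hh⟩ := hε.exists_precomp_eq (hr.precomp c) hcε
    rw [Ext.mk₀_comp_mk₀_assoc] at hh
    rcases isIso_or_isIso_of_add_eq_id (add_sub_cancel (h ≫ c) (𝟙 W)) with _ | _
    · exact hc ⟨⟨⟨inv (h ≫ c) ≫ h, by simp⟩⟩⟩
    · apply hne
      have hz : (Ext.mk₀ (𝟙 W - h ≫ c)).comp ε (zero_add 1) = 0 := by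
        rw [sub_eq_add_neg, Ext.mk₀_add, Ext.mk₀_neg, Ext.add_comp, Ext.neg_comp, hh,
          Ext.mk₀_id_comp, add_neg_cancel]
      have h2 : (Ext.mk₀ (inv (𝟙 W - h ≫ c))).comp
          ((Ext.mk₀ (𝟙 W - h ≫ c)).comp ε (zero_add 1)) (zero_add 1) = ε := by
        rw [Ext.mk₀_comp_mk₀_assoc, IsIso.inv_hom_id, Ext.mk₀_id_comp]
      rw [← h2, hz, Ext.comp_zero]
  obtain ⟨E, i, p, w, hS, rfl⟩ := hr
  exact ⟨E, i, p, w, hS, hne, hε, key⟩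

lemma exists_comp_biproduct_π_ne_zero_s16 {n : ℕ} {Z : Fin n → 𝒜} {X T : 𝒜} (φ : X ≅ ⨁ Z)
    (ε : Ext T X 1) (hε : ε ≠ 0) :
    ∃ j, ε.comp (Ext.mk₀ (φ.hom ≫ biproduct.π Z j)) (add_zero 1) ≠ 0 := by
  by_contra! h
  apply hε
  rw [← Ext.comp_mk₀_id ε, ← sum_biproduct_decomposition φ, Ext.mk₀_sum, Ext.comp_sum]
  refine Finset.sum_eq_zero fun j _ => ?_
  rw [← Ext.mk₀_comp_mk₀, ← Ext.comp_assoc_of_third_deg_zero, h j, Ext.zero_comp]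

lemma exists_biproduct_ι_comp_ne_zero {n : ℕ} {Z : Fin n → 𝒜} {X T : 𝒜} (φ : X ≅ ⨁ Z)
    (ε : Ext X T 1) (hε : ε ≠ 0) :
    ∃ j, (Ext.mk₀ (biproduct.ι Z j ≫ φ.inv)).comp ε (zero_add 1) ≠ 0 := by
  by_contra! h
  apply hε
  rw [← Ext.mk₀_id_comp ε, ← sum_biproduct_decomposition φ, Ext.mk₀_sum, Ext.sum_comp]
  refine Finset.sum_eq_zero fun j _ => ?_
  rw [← Ext.mk₀_comp_mk₀_assoc, h j, Ext.comp_zero]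

lemma factorsThru_iff_comp_extClass_eq_zero_s16 {K X Y T : 𝒜} {ι : K ⟶ X} {f : X ⟶ Y}
    {w : ι ≫ f = 0} (hS : (ShortComplex.mk ι f w).ShortExact) (g : T ⟶ Y) :
    FactorsThru g f ↔ (Ext.mk₀ g).comp hS.extClass (zero_add 1) = 0 := by
  constructor
  · rintro ⟨t, rfl⟩
    rw [← Ext.mk₀_comp_mk₀_assoc]
    erw [hS.comp_extClass]
    rw [Ext.comp_zero]
  · intro h
    obtain ⟨x, hx⟩ := Ext.covariant_sequence_exact₃ T hS (Ext.mk₀ g) (zero_add 1) h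
    obtain ⟨t, rfl⟩ := (Ext.mk₀_bijective _ _).2 x
    exact ⟨t, (Ext.mk₀_bijective _ _).1 (by rw [← hx, Ext.mk₀_comp_mk₀])⟩

end ExtensionClasses

section Determined

variable [HasExt.{w} 𝒜]

lemma exists_ne_zero_comp_eq_zero {Z E T C : 𝒜} [IsLocalRing (End Z)] {i : Z ⟶ E} {p : E ⟶ T}
    {w : i ≫ p = 0} (hS : (ShortComplex.mk i p w).ShortExact) (hi : ¬ IsSplitMono i)
    (hC : ∀ (T' : 𝒜) (g : T' ⟶ T), (Ext.mk₀ g).comp hS.extClass (zero_add 1) ≠ 0 →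
      ∃ h : C ⟶ T', (Ext.mk₀ (h ≫ g)).comp hS.extClass (zero_add 1) ≠ 0)
    (A : 𝒜) (a : Z ⟶ A) (ha : ¬ IsSplitMono a) :
    ∃ ε : Ext C Z 1, ε ≠ 0 ∧ ε.comp (Ext.mk₀ a) (add_zero 1) = 0 := by
  have : Mono i := hS.mono_f
  have hb := not_isSplitMono_biprod_lift ha hi
  set b := biprod.lift a i with hb_def
  have : Mono b := mono_of_mono_fac (biprod.lift_snd a i)
  have hB : (ShortComplex.mk b (cokernel.π b) (cokernel.condition b)).ShortExact :=
    { exact := ShortComplex.exact_cokernel b, mono_f := ‹_›, epi_g := inferInstance }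
  let t : cokernel b ⟶ T := cokernel.desc b (biprod.snd ≫ p) (by simp [hb_def, w])
  have hnat := ShortComplex.ShortExact.extClass_naturality hB hS
    { τ₁ := 𝟙 Z, τ₂ := biprod.snd, τ₃ := t,
      comm₁₂ := (Category.id_comp i).trans (biprod.lift_snd a i).symm,
      comm₂₃ := (cokernel.π_desc b _ _).symm }
  have hζ : hB.extClass = (Ext.mk₀ t).comp hS.extClass (zero_add 1) := by simpa using hnat
  have hζ₀ : hB.extClass ≠ 0 := by
    intro h0
    obtain ⟨x, hx⟩ := Ext.contravariant_sequence_exact₁ hB Z (Ext.mk₀ (𝟙 Z)) (add_zero 1)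
      (by rw [h0, Ext.zero_comp])
    obtain ⟨s, rfl⟩ := (Ext.mk₀_bijective _ _).2 x
    exact hb ⟨⟨s, (Ext.mk₀_bijective _ _).1 (by rw [← hx, Ext.mk₀_comp_mk₀])⟩⟩
  obtain ⟨h, hh⟩ := hC _ t (hζ ▸ hζ₀)
  rw [← Ext.mk₀_comp_mk₀_assoc, ← hζ] at hh
  refine ⟨_, hh, ?_⟩
  have hab : a = b ≫ biprod.fst := (biprod.lift_fst a i).symm
  have hb0 : hB.extClass.comp (Ext.mk₀ b) (add_zero 1) = 0 := hB.extClass_comp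
  rw [Ext.comp_assoc_of_third_deg_zero, hab, ← Ext.mk₀_comp_mk₀,
    ← Ext.comp_assoc_of_third_deg_zero hB.extClass, hb0, Ext.zero_comp, Ext.comp_zero]

variable {k : Type*} [Field k] [Linear k 𝒜]

variable (k) in
/-- Pushing out along `a`, as a linear map on `Ext¹`. -/
noncomputable def extPostcomp (C : 𝒜) {Z A : 𝒜} (a : Z ⟶ A) : Ext C Z 1 →ₗ[k] Ext C A 1 where
  toFun ε := ε.comp (Ext.mk₀ a) (add_zero 1)
  map_add' _ _ := Ext.add_comp _ _ _ _
  map_smul' _ _ := Ext.comp_assoc_of_third_deg_zero _ _ _ _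

lemma exists_killedByNonSections {C Z : 𝒜} [IsLocalRing (End Z)]
    [FiniteDimensional k (Ext C Z 1)]
    (h : ∀ (A : 𝒜) (a : Z ⟶ A), ¬ IsSplitMono a →
      ∃ ε : Ext C Z 1, ε ≠ 0 ∧ ε.comp (Ext.mk₀ a) (add_zero 1) = 0)
    {A₁ : 𝒜} (a₁ : Z ⟶ A₁) (ha₁ : ¬ IsSplitMono a₁) :
    ∃ ε : Ext C Z 1, ε ≠ 0 ∧ KilledByNonSections ε := by
  obtain ⟨_, ⟨A₀, a₀, ha₀, rfl⟩, hmin⟩ := IsArtinian.set_has_minimal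
    {N : Submodule k (Ext C Z 1) |
      ∃ (A : 𝒜) (a : Z ⟶ A), ¬ IsSplitMono a ∧ N = LinearMap.ker (extPostcomp k C a)}
    ⟨_, A₁, a₁, ha₁, rfl⟩
  obtain ⟨ε, hε, hε₀⟩ := h A₀ a₀ ha₀
  refine ⟨ε, hε, fun A a ha => ?_⟩
  have hle : LinearMap.ker (extPostcomp k C (biprod.lift a₀ a)) ≤
      LinearMap.ker (extPostcomp k C a₀) := by
    intro x (hx : x.comp (Ext.mk₀ _) (add_zero 1) = 0)
    change x.comp (Ext.mk₀ a₀) (add_zero 1) = 0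
    rw [← biprod.lift_fst a₀ a, ← Ext.mk₀_comp_mk₀, ← Ext.comp_assoc_of_third_deg_zero, hx,
      Ext.zero_comp]
  have hmem : ε ∈ LinearMap.ker (extPostcomp k C (biprod.lift a₀ a)) := by
    rw [eq_of_le_of_not_lt hle (hmin _ ⟨_, _, not_isSplitMono_biprod_lift ha₀ ha, rfl⟩)]
    exact hε₀
  have hx : ε.comp (Ext.mk₀ (biprod.lift a₀ a)) (add_zero 1) = 0 := hmem
  rw [← biprod.lift_snd a₀ a, ← Ext.mk₀_comp_mk₀, ← Ext.comp_assoc_of_third_deg_zero, hx,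
    Ext.zero_comp]

lemma existsAlmostSplitStartingAt_of_rightDetermined
    (extFin : ∀ A B : 𝒜, FiniteDimensional k (Ext A B 1)) (hKS : IsKrullSchmidtCat 𝒜)
    {C X Y K Z : 𝒜} {f : X ⟶ Y} (hf : RightDetermined C f) (hmin : RightMinimal f)
    {ι : K ⟶ X} {w : ι ≫ f = 0} (hS : (ShortComplex.mk ι f w).ShortExact)
    (hZK : IsDirectSummand Z K) (hZ : Indec Z) : ExistsAlmostSplitStartingAt Z := by
  obtain ⟨j, r, hjr⟩ := hZK
  have := isLocalRing_end_of_indec hKS hZ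
  have : Mono ι := hS.mono_f
  have : Mono j := mono_of_mono_fac hjr
  have : IsSplitMono j := ⟨⟨r, hjr⟩⟩
  have hi := not_isSplitMono_of_rightMinimal hmin hZ.1 (j ≫ ι) (by simp [w])
  set i := j ≫ ι with hi_def
  have hB : (ShortComplex.mk i (cokernel.π i) (cokernel.condition i)).ShortExact :=
    { exact := ShortComplex.exact_cokernel i, mono_f := mono_comp j ι, epi_g := inferInstance }
  let γ : cokernel i ⟶ Y := cokernel.desc i f (by simp [hi_def, w])
  have hnat : hB.extClass.comp (Ext.mk₀ j) (add_zero 1) =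
      (Ext.mk₀ γ).comp hS.extClass (zero_add 1) :=
    ShortComplex.ShortExact.extClass_naturality hB hS
      { τ₁ := j, τ₂ := 𝟙 X, τ₃ := γ,
        comm₁₂ := (Category.comp_id _).symm,
        comm₂₃ := (Category.id_comp f).trans (cokernel.π_desc i _ _).symm }
  have hnat' (T' : 𝒜) (g : T' ⟶ cokernel i) :
      (Ext.mk₀ (g ≫ γ)).comp hS.extClass (zero_add 1) =
        ((Ext.mk₀ g).comp hB.extClass (zero_add 1)).comp (Ext.mk₀ j) (add_zero 1) := by
    rw [← Ext.mk₀_comp_mk₀_assoc, ← hnat, Ext.comp_assoc_of_third_deg_zero]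
  have hC (T' : 𝒜) (g : T' ⟶ cokernel i)
      (hg : (Ext.mk₀ g).comp hB.extClass (zero_add 1) ≠ 0) :
      ∃ h : C ⟶ T', (Ext.mk₀ (h ≫ g)).comp hB.extClass (zero_add 1) ≠ 0 := by
    by_contra! h0
    apply hg
    apply eq_zero_of_comp_isSplitMono _ j
    rw [← hnat', ← factorsThru_iff_comp_extClass_eq_zero_s16 hS]
    refine hf _ _ fun h => ?_
    rw [factorsThru_iff_comp_extClass_eq_zero_s16 hS, ← Category.assoc, hnat', h0, Ext.zero_comp]
  have := extFin C Z
  obtain ⟨ε, hε, hkill⟩ := exists_killedByNonSections (k := k)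
    (exists_ne_zero_comp_eq_zero hB hi hC) i hi
  have hθ : hB.extClass ≠ 0 := by
    intro h0
    obtain ⟨ε', hε', hε'₀⟩ := exists_ne_zero_comp_eq_zero hB hi hC _ i hi
    obtain ⟨x, rfl⟩ := Ext.covariant_sequence_exact₁ C hB ε' hε'₀ (zero_add 1)
    exact hε' (by rw [h0, Ext.comp_zero])
  obtain ⟨h, rfl⟩ := hkill.exists_precomp_eq ⟨_, _, _, _, hB, rfl⟩ hθ
  obtain ⟨n, F, ⟨φ⟩, hF⟩ := hKS C
  obtain ⟨l, hl⟩ := exists_biproduct_ι_comp_ne_zero φ _ hε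
  have := hF l
  have hB' : IsExtensionClass hB.extClass := ⟨_, _, _, _, hB, rfl⟩
  exact ⟨F l, existsAlmostSplitSeq_of_killedByNonSections ((hB'.precomp h).precomp _) hl
    (hkill.precomp _)⟩

lemma exists_rightDetermined_of_summands (hKS : IsKrullSchmidtCat 𝒜)
    {X Y K : 𝒜} {f : X ⟶ Y} {ι : K ⟶ X} {w : ι ≫ f = 0}
    (hS : (ShortComplex.mk ι f w).ShortExact)
    (h : ∀ Z : 𝒜, IsDirectSummand Z K → Indec Z →
      (IsExtInjective Z ∨ ExistsAlmostSplitStartingAt Z)) : ∃ C : 𝒜, RightDetermined C f := by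
  obtain ⟨n, F, ⟨φ⟩, hF⟩ := hKS K
  have hW (j : Fin n) : ∃ W : 𝒜, ∀ (T : 𝒜) (e : Ext T (F j) 1), IsExtensionClass e → e ≠ 0 →
      ∃ c : W ⟶ T, (Ext.mk₀ c).comp e (zero_add 1) ≠ 0 := by
    have := hF j
    rcases h (F j) ⟨biproduct.ι F j ≫ φ.inv, φ.hom ≫ biproduct.π F j, by simp⟩
      (indec_of_isLocalRing_end _) with hinj | ⟨W, E, i, p, w, hE, hne, hkill, -⟩
    · exact ⟨Y, fun T e _ he => absurd (hinj T e) he⟩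
    · refine ⟨W, fun T e he he₀ => ?_⟩
      obtain ⟨c, hc⟩ := KilledByNonSections.exists_precomp_eq (ε := hE.extClass) hkill he he₀
      exact ⟨c, hc ▸ hne⟩
  choose W hW using hW
  refine ⟨⨁ W, fun T g hg => ?_⟩
  rw [factorsThru_iff_comp_extClass_eq_zero_s16 hS]
  by_contra hne
  obtain ⟨j, hj⟩ := exists_comp_biproduct_π_ne_zero_s16 φ _ hne
  have hE : IsExtensionClass hS.extClass := ⟨_, _, _, _, hS, rfl⟩
  obtain ⟨c, hc⟩ := hW j T _ ((hE.precomp g).postcomp _) hj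
  apply hc
  have h₁ := hg (biproduct.π W j ≫ c)
  rw [factorsThru_iff_comp_extClass_eq_zero_s16 hS] at h₁
  have h₂ : (Ext.mk₀ (c ≫ g)).comp hS.extClass (zero_add 1) = 0 := by
    have : c ≫ g = biproduct.ι W j ≫ (biproduct.π W j ≫ c) ≫ g := by simp
    rw [this, ← Ext.mk₀_comp_mk₀_assoc, h₁, Ext.comp_zero]
  rw [← Ext.comp_assoc_of_third_deg_zero, Ext.mk₀_comp_mk₀_assoc, h₂, Ext.zero_comp]

end Determined

/-- an epimorphism is right determined by some object iff the kernel
of its right minimal version lies in `𝒜_l`. -/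
theorem statement_16 {k : Type*} [Field k] [Linear k 𝒜] [HasExt.{w} 𝒜]
    (homFin : ∀ A B : 𝒜, FiniteDimensional k (A ⟶ B))
    (extFin : ∀ A B : 𝒜, FiniteDimensional k (Abelian.Ext A B 1))
    (hKS : IsKrullSchmidtCat 𝒜)
    {X X' Y K' : 𝒜} (α : X ⟶ Y) (hα : Epi α)
    (α' : X' ⟶ Y) (hα' : Epi α') (hmin : RightMinimal α')
    (h₁ : FactorsThru α α') (h₂ : FactorsThru α' α)
    (ι : K' ⟶ X') (w : ι ≫ α' = 0) (hS : (ShortComplex.mk ι α' w).ShortExact) :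
    (∃ C : 𝒜, RightDetermined C α) ↔
      (∀ Z : 𝒜, IsDirectSummand Z K' → Indec Z →
        (IsExtInjective Z ∨ ExistsAlmostSplitStartingAt Z)) := by
  constructor
  · rintro ⟨C, hC⟩ Z hZK hZ
    exact .inr (existsAlmostSplitStartingAt_of_rightDetermined extFin hKS (hC.congr h₁ h₂) hmin
      hS hZK hZ)
  · intro h
    obtain ⟨C, hC⟩ := exists_rightDetermined_of_summands hKS hS h
    exact ⟨C, hC.congr h₂ h₁⟩
end
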